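/- Let Π be a Towers of Hanoi instance with k disks, let 1 ≤ i < k, let x = init(on-d_{i+1}), let x' ∈ {p2,p3}, and let y be the element of {p2,p3} \ {x'}. Put a1 = subtow-pos_{i, d_{i+1}, y}, a2 = move_{d_{i+1}, x, x'}, and a3 = ⟨clear-d1=T, on-d1=d2, …, on-d_{i-1}=d_i, on-d_i=y, clear-d_{i+1}=T; on-d_i=d_{i+1}, clear-y=T, clear-d_{i+1}=F⟩ (the action moving the top-i tower from y back onto d_{i+1}). Then a1 is applicable at init, a2 is applicable at init[a1], a3 is applicable at init[a1,a2]; the states init[a1], init[a1,a2], init[a1,a2,a3] all lie in H(init,7); and init[a1,a2,a3] = init[subtow-pos_{i+1,x,x'}]. -/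

import Mathlib

namespace OnTheFlyMacros

noncomputable section
attribute [local instance] Classical.propDecidable

variable {V : Type*} {Val : Type*}

/-- A partial state: a partial map from variables to values.
`vars p` is the set of variables where it is defined. -/
abbrev PState (V Val : Type*) := V → Option Val

/-- `vars(p)`, the set of variables on which the partial state is defined. -/
def pvars (p : PState V Val) : Set V := {v | p v ≠ none}

/-- Restriction of a partial state to a set of variables. -/
def prestrict (p : PState V Val) (R : Set V) : PState V Val :=
  fun v => if v ∈ R then p v else none

/-- Union of partial states, viewed as sets of variable–value pairs
(left-biased; coincides with relational union for compatible partial states). -/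
def punion (p q : PState V Val) : PState V Val :=
  fun v => (p v).orElse (fun _ => q v)

/-- Set difference of partial states viewed as sets of variable–value pairs. -/
def pdiff (p q : PState V Val) : PState V Val :=
  fun v =>
    match p v with
    | none => none
    | some x => if q v = some x then none else some x

/-- Containment of partial states viewed as sets of variable–value pairs. -/
def psub (p q : PState V Val) : Prop := ∀ v x, p v = some x → q v = some x

/-- Strict containment of partial states viewed as sets of variable–value pairs. -/
def psubStrict (p q : PState V Val) : Prop := psub p q ∧ ¬ psub q p

/-- An action: a pair of a precondition and a postcondition. -/
structure PAct (V Val : Type*) where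
  pre : PState V Val
  post : PState V Val

/-- The `combine` operation on actions. -/
def combine (a a' : PAct V Val) : PAct V Val :=
  let R := pvars a.pre \ pvars a.post
  let S := punion a.post (prestrict a.pre R)
  let O := pvars a.post \ pvars a'.post
  let pr := punion a.pre (pdiff a'.pre S)
  let pos := punion a'.post (prestrict a.post O)
  ⟨pr, pdiff pos pr⟩

/-- `a` is applicable at state `s`: `s` agrees with `pre(a)` on `vars(pre(a))`. -/
def Applicable (s : V → Val) (a : PAct V Val) : Prop :=
  ∀ v x, a.pre v = some x → s v = x

/-- `s[a]`: the result of applying action `a` at state `s`. -/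
def appA (s : V → Val) (a : PAct V Val) : V → Val :=
  if Applicable s a then (fun v => (a.post v).getD (s v)) else s

/-- `s[P]`: the result of applying a plan `P` at state `s`. -/
def appP (s : V → Val) (P : List (PAct V Val)) : V → Val := P.foldl appA s

/-- Hamming distance between two states. -/
def ham (s t : V → Val) : ℕ := Set.ncard {v | s v ≠ t v}

/-- `H(s,k)`: all states (respecting the variable domains `D`) within Hamming
distance `k` of `s`. -/
def Hball (D : V → Set Val) (s : V → Val) (k : ℕ) : Set (V → Val) :=
  {t | (∀ v, t v ∈ D v) ∧ ham s t ≤ k}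

/-- A partial state given by a finite list of variable–value pairs. -/
def pOf {V Val : Type*} [DecidableEq V] (l : List (V × Val)) : PState V Val :=
  fun v => (l.find? (fun q => decide (q.1 = v))).map Prod.snd

/-- An action graph: vertices are states, each present edge has exactly one
action label (`label s s' = some a` means there is an edge `(s,s')` with label `a`). -/
structure AGraph (V Val : Type*) where
  verts : Set (V → Val)
  label : (V → Val) → (V → Val) → Option (PAct V Val)

/-- `a` appears as an edge label in `G`. -/
def IsEdgeLabel (G : AGraph V Val) (a : PAct V Val) : Prop :=
  ∃ s s', G.label s s' = some a

/-- The `better` test. -/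
def better (a : PAct V Val) (s s' : V → Val) (G : AGraph V Val) : Prop :=
  match G.label s s' with
  | none => True
  | some b =>
      (psubStrict a.pre b.pre ∧ psub a.post b.post) ∨
      (psub a.pre b.pre ∧ psubStrict a.post b.post)

/-- The `addlabel` operation. -/
def addlabel (G : AGraph V Val) (s s' : V → Val) (a : PAct V Val) : AGraph V Val :=
  ⟨G.verts, fun t t' => if t = s ∧ t' = s' then some a else G.label t t'⟩

/-- The `apply` operation on action graphs. -/
def applyCmd (G : AGraph V Val) (A : Set (PAct V Val)) (a : PAct V Val) (s : V → Val) :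
    AGraph V Val :=
  if (a ∈ A ∨ IsEdgeLabel G a) ∧ appA s a ≠ s ∧ appA s a ∈ G.verts ∧
      better a s (appA s a) G
  then addlabel G s (appA s a) a
  else G

/-- The `transitive` operation on action graphs. -/
def transCmd (G : AGraph V Val) (s1 s2 s3 : V → Val) : AGraph V Val :=
  match G.label s1 s2, G.label s2 s3 with
  | some a, some a' =>
      if better (combine a a') s1 s3 G then addlabel G s1 s3 (combine a a') else G
  | _, _ => G

/-- `transitive(G,s1,s2,s3)` produces the transition `(s1, b, s3)`. -/
def ProducesTr (G : AGraph V Val) (s1 s2 s3 : V → Val) (b : PAct V Val) : Prop :=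
  ∃ a a', G.label s1 s2 = some a ∧ G.label s2 s3 = some a' ∧
    better (combine a a') s1 s3 G ∧ b = combine a a'

/-- A command of an action graph program. -/
inductive Cmd (V Val : Type*) where
  | app : PAct V Val → (V → Val) → Cmd V Val
  | tr : (V → Val) → (V → Val) → (V → Val) → Cmd V Val

/-- The states mentioned by a command all belong to `S`. -/
def CmdOver (S : Set (V → Val)) : Cmd V Val → Prop
  | .app _ s => s ∈ S
  | .tr s1 s2 s3 => s1 ∈ S ∧ s2 ∈ S ∧ s3 ∈ S

/-- Executing one command (with action set `A`). -/
def stepCmd (A : Set (PAct V Val)) (G : AGraph V Val) : Cmd V Val → AGraph V Val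
  | .app a s => applyCmd G A a s
  | .tr s1 s2 s3 => transCmd G s1 s2 s3

/-- Executing an action graph program starting from graph `G`. -/
def execFrom (A : Set (PAct V Val)) (G : AGraph V Val) (prog : List (Cmd V Val)) :
    AGraph V Val :=
  prog.foldl (stepCmd A) G

/-- The edgeless action graph with vertex set `S`. -/
def emptyGraph (S : Set (V → Val)) : AGraph V Val := ⟨S, fun _ _ => none⟩

/-- Combinations over `A`: actions of `A` closed under `combine`. -/
inductive Comb (A : Set (PAct V Val)) : PAct V Val → Prop
  | base {a} : a ∈ A → Comb A a
  | comb {a a'} : Comb A a → Comb A a' → Comb A (combine a a')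

/-- The transition `(s,a,s')` is condition-minimal with respect to `A`. -/
def CondMin (A : Set (PAct V Val)) (s : V → Val) (a : PAct V Val) (s' : V → Val) : Prop :=
  Applicable s a ∧ appA s a = s' ∧
    ∀ b, Comb A b → appA s b = s' → psub a.pre b.pre ∧ psub a.post b.post

/-- The program, executed from graph `G` with action set `A'`, passes `apply` only
condition-minimal (w.r.t. `A`) pairs and its `transitive` commands produce only
condition-minimal (w.r.t. `A`) transitions. -/
def IsCMFrom (A A' : Set (PAct V Val)) : AGraph V Val → List (Cmd V Val) → Prop
  | _, [] => True
  | G, (.app a s) :: rest =>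
      CondMin A s a (appA s a) ∧ IsCMFrom A A' (applyCmd G A' a s) rest
  | G, (.tr s1 s2 s3) :: rest =>
      (∀ b, ProducesTr G s1 s2 s3 b → CondMin A s1 b s3) ∧
      IsCMFrom A A' (transCmd G s1 s2 s3) rest

/-- Some `transitive` command of the program (executed from `G` with action set `A'`)
produces a transition whose action is `b`. -/
def ProducesIn (A' : Set (PAct V Val)) : AGraph V Val → List (Cmd V Val) → PAct V Val → Prop
  | _, [], _ => False
  | G, (.app a s) :: rest, b => ProducesIn A' (applyCmd G A' a s) rest b
  | G, (.tr s1 s2 s3) :: rest, b =>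
      ProducesTr G s1 s2 s3 b ∨ ProducesIn A' (transCmd G s1 s2 s3) rest b

/-- `b` is the action of a transition produced by some `A`-CM-program over states `S`
and actions `A'`. -/
def ProducedOver (S : Set (V → Val)) (A A' : Set (PAct V Val)) (b : PAct V Val) : Prop :=
  ∃ prog : List (Cmd V Val), (∀ c ∈ prog, CmdOver S c) ∧
    IsCMFrom A A' (emptyGraph S) prog ∧ ProducesIn A' (emptyGraph S) prog b

/-- The set of `(S,A)`-derivable actions: the smallest set `X` of actions such that
any action of a transition produced by an `A`-CM-program over states `S` and the
actions `X ∪ A` belongs to `X`. -/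
def Derivable (S : Set (V → Val)) (A : Set (PAct V Val)) : Set (PAct V Val) :=
  ⋂₀ {X : Set (PAct V Val) | ∀ b, ProducedOver S A (X ∪ A) b → b ∈ X}

/-- `s` is a goal state for the partial state `goal`. -/
def GoalSt (goal : PState V Val) (s : V → Val) : Prop :=
  ∀ v x, goal v = some x → s v = x

/-- `wrong(s)`: variables of `vars(goal)` not at their goal value. -/
def wrongSet (goal : PState V Val) (s : V → Val) : Set V :=
  {v | ∃ x, goal v = some x ∧ s v ≠ x}

/-- `s'` is an improvement of `s`. -/
def Improvement (goal : PState V Val) (s s' : V → Val) : Prop :=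
  (∀ v x, goal v = some x → s v = x → s' v = x) ∧
  (∃ u x, goal u = some x ∧ s u ≠ x ∧ s' u = x)

/-- The plan `P` improves the state `s`. -/
def PlanImproves (goal : PState V Val) (s : V → Val) (P : List (PAct V Val)) : Prop :=
  GoalSt goal (appP s P) ∨ Improvement goal s (appP s P)

/-- The plan `P`, executed from `s`, stays within Hamming distance `k` of `s`
(all intermediate states and the final state). -/
def StaysWithin (k : ℕ) (s : V → Val) (P : List (PAct V Val)) : Prop :=
  ∀ Q : List (PAct V Val), Q <+: P → ham s (appP s Q) ≤ k

/-- `s` dominates `s0`. -/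
def Dominates (goal : PState V Val) (s s0 : V → Val) : Prop :=
  {v | s v ≠ s0 v} ⊆ pvars goal ∧ wrongSet goal s ⊆ wrongSet goal s0

/-- `s` is reachable from `init` by a plan over `A`. -/
def Reachable (A : Set (PAct V Val)) (init s : V → Val) : Prop :=
  ∃ P : List (PAct V Val), (∀ a ∈ P, a ∈ A) ∧ appP init P = s

/-- Some plan over `A` solves the instance. -/
def Solvable (init : V → Val) (goal : PState V Val) (A : Set (PAct V Val)) : Prop :=
  ∃ P : List (PAct V Val), (∀ a ∈ P, a ∈ A) ∧ GoalSt goal (appP init P)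

/-- The instance has persistent Hamming width `k`. -/
def PHWidth (init : V → Val) (goal : PState V Val) (A : Set (PAct V Val)) (k : ℕ) : Prop :=
  ¬ Solvable init goal A ∨
    ∀ s : V → Val, Reachable A init s →
      ∃ P : List (PAct V Val), (∀ a ∈ P, a ∈ A) ∧ PlanImproves goal s P ∧ StaysWithin k s P

/-- The instance has macro persistent Hamming width `k`. -/
def MPHWidth (D : V → Set Val) (init : V → Val) (goal : PState V Val)
    (A : Set (PAct V Val)) (k : ℕ) : Prop :=
  ¬ Solvable init goal A ∨
    ∀ s : V → Val, Reachable A init s → Dominates goal s init →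
      ∃ P : List (PAct V Val), (∀ a ∈ P, a ∈ Derivable (Hball D s k) A) ∧
        PlanImproves goal s P ∧ StaysWithin k s P

end

end OnTheFlyMacros
namespace OnTheFlyMacros

noncomputable section
attribute [local instance] Classical.propDecidable

/-- Positions of a Towers of Hanoi instance with `k` disks:
disks (`disk i` is `d_{i+1}`) and the three pegs. -/
inductive HPos (k : ℕ) where
  | disk : Fin k → HPos k
  | peg : Fin 3 → HPos k
deriving DecidableEq

/-- Variables of a Towers of Hanoi instance with `k` disks. -/
inductive HVar (k : ℕ) where
  | on : Fin k → HVar k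
  | clear : HPos k → HVar k
deriving DecidableEq

/-- Values of a Towers of Hanoi instance with `k` disks. -/
inductive HVal (k : ℕ) where
  | pos : HPos k → HVal k
  | T : HVal k
  | F : HVal k
deriving DecidableEq

/-- Domains of the Towers of Hanoi variables. -/
def hD {k : ℕ} : HVar k → Set (HVal k)
  | .on _ => {x | ∃ p, x = .pos p}
  | .clear _ => {x | x = .T ∨ x = .F}

/-- Disk `d` is smaller than position `x` (every disk is smaller than every peg). -/
def dlt {k : ℕ} (d : Fin k) : HPos k → Prop
  | .disk j => d < j
  | .peg _ => True

/-- `move_{d,xf,xt}`: move disk `d` from position `xf` to position `xt`. -/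
def hMove {k : ℕ} (d : Fin k) (xf xt : HPos k) : PAct (HVar k) (HVal k) :=
  ⟨pOf [(.clear (.disk d), .T), (.clear xt, .T), (.on d, .pos xf)],
   pOf [(.clear xt, .F), (.clear xf, .T), (.on d, .pos xt)]⟩

/-- The action set of the Towers of Hanoi instance with `k` disks. -/
def hanoiActs (k : ℕ) : Set (PAct (HVar k) (HVal k)) :=
  {a | ∃ d xf xt, dlt d xt ∧ a = hMove d xf xt}

/-- The position disk `d_{i+1}` (0-indexed: `disk i`) is on in the initial state. -/
def initPos {k : ℕ} (i : Fin k) : HPos k :=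
  if h : (i : ℕ) + 1 < k then .disk ⟨(i : ℕ) + 1, h⟩ else .peg 0

/-- The initial state of the Towers of Hanoi instance with `k` disks. -/
def hInit (k : ℕ) : HVar k → HVal k
  | .on i => .pos (initPos i)
  | .clear (.disk i) => if (i : ℕ) = 0 then .T else .F
  | .clear (.peg j) => if (j : ℕ) = 0 then .F else .T

/-- The (total) goal state of the Towers of Hanoi instance with `k` disks. -/
def hGoal (k : ℕ) : HVar k → HVal k
  | .on i => if h : (i : ℕ) + 1 < k then .pos (.disk ⟨(i : ℕ) + 1, h⟩) else .pos (.peg 2)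
  | .clear (.disk i) => if (i : ℕ) = 0 then .T else .F
  | .clear (.peg j) => if (j : ℕ) = 2 then .F else .T

/-- `subtow-pos_{i+1,x,x'}` (0-indexed `i`): move the tower consisting of the
topmost `i+1` disks from `x` to `x'`. -/
def subtowPos {k : ℕ} (i : Fin k) (x x' : HPos k) : PAct (HVar k) (HVal k) where
  pre := fun v =>
    match v with
    | .on j =>
        if j = i then some (.pos x)
        else if h : (j : ℕ) + 1 ≤ (i : ℕ) then
          some (.pos (.disk ⟨(j : ℕ) + 1, lt_of_le_of_lt h i.isLt⟩))
        else none
    | .clear y =>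
        if y = HPos.disk ⟨0, i.pos⟩ then some .T
        else if y = x' then some .T else none
  post := fun v =>
    match v with
    | .on j => if j = i then some (.pos x') else none
    | .clear y =>
        if y = x then some .T
        else if y = x' then some .F else none

end

end OnTheFlyMacros

namespace OnTheFlyMacros

noncomputable section
attribute [local instance] Classical.propDecidable

/-- The state obtained from `s` by putting disk `d` on `x'`, making `x` clear and `x'` not clear. -/
def relocate {k : ℕ} (s : HVar k → HVal k) (d : Fin k) (x x' : HPos k) : HVar k → HVal k :=
  Function.update (Function.update (Function.update s (.on d) (.pos x')) (.clear x') .F)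
    (.clear x) .T

theorem relocate_apply {k : ℕ} (s : HVar k → HVal k) (d : Fin k) (x x' : HPos k) (v : HVar k) :
    relocate s d x x' v = if v = .clear x then .T else if v = .clear x' then .F
      else if v = .on d then .pos x' else s v := by
  simp only [relocate, Function.update_apply]

theorem appA_subtowPos {k : ℕ} {s : HVar k → HVal k} {i : Fin k} {x x' : HPos k}
    (happ : Applicable s (subtowPos i x x')) :
    appA s (subtowPos i x x') = relocate s i x x' := by
  rw [appA, if_pos happ]
  funext v
  rw [relocate_apply]
  cases v <;> simp only [subtowPos, HVar.on.injEq, HVar.clear.injEq, reduceCtorEq, if_false] <;>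
    split_ifs <;> rfl

theorem appA_hMove {k : ℕ} {s : HVar k → HVal k} {d : Fin k} {x x' : HPos k} (hne : x ≠ x')
    (happ : Applicable s (hMove d x x')) :
    appA s (hMove d x x') = relocate s d x x' := by
  rw [appA, if_pos happ]
  funext v
  rw [relocate_apply]
  simp only [hMove, pOf, List.find?_cons, List.find?_nil]
  grind

theorem applicable_subtowPos {k : ℕ} {s : HVar k → HVal k} {i : Fin k} {x x' : HPos k}
    (hon : s (.on i) = .pos x)
    (htower : ∀ (l : Fin k) (hl : (l : ℕ) + 1 ≤ (i : ℕ)),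
      s (.on l) = .pos (.disk ⟨(l : ℕ) + 1, lt_of_le_of_lt hl i.isLt⟩))
    (htop : s (.clear (.disk ⟨0, i.pos⟩)) = .T) (hclear : s (.clear x') = .T) :
    Applicable s (subtowPos i x x') := by
  intro v z hv
  cases v <;> simp only [subtowPos] at hv <;> grind

theorem applicable_hMove {k : ℕ} {s : HVar k → HVal k} {d : Fin k} {x x' : HPos k}
    (hon : s (.on d) = .pos x) (htop : s (.clear (.disk d)) = .T)
    (hclear : s (.clear x') = .T) :
    Applicable s (hMove d x x') := by
  intro v z hv
  simp only [hMove, pOf, List.find?_cons, List.find?_nil] at hv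
  grind

/-- Moving `d` away, moving `d'`, and moving `d` back only relocates `d'`. -/
theorem relocate_conj {k : ℕ} {s : HVar k → HVal k} {d d' : Fin k} {x x' y z : HPos k}
    (hd : d ≠ d') (hxy : x ≠ y) (hxz : x ≠ z) (hxy' : x' ≠ y) (hxz' : x' ≠ z)
    (hon : s (.on d) = .pos z) (hz : s (.clear z) = .F) (hy : s (.clear y) = .T) :
    relocate (relocate (relocate s d z y) d' x x') d y z = relocate s d' x x' := by
  funext v
  simp only [relocate_apply]
  grind

theorem relocate_mem_hD {k : ℕ} {s : HVar k → HVal k} (hs : ∀ v, s v ∈ hD v) (d : Fin k)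
    (x x' : HPos k) (v : HVar k) : relocate s d x x' v ∈ hD v := by
  rw [relocate_apply]
  split_ifs with h₁ h₂ h₃
  · subst h₁; exact Or.inl rfl
  · subst h₂; exact Or.inr rfl
  · subst h₃; exact ⟨x', rfl⟩
  · exact hs v

theorem finite_hVar (k : ℕ) : Finite (HVar k) := by
  let f : Fin k ⊕ Fin k ⊕ Fin 3 → HVar k
    | .inl d => .on d
    | .inr (.inl d) => .clear (.disk d)
    | .inr (.inr p) => .clear (.peg p)
  refine Finite.of_surjective f ?_
  rintro (d | d | p)
  exacts [⟨.inl d, rfl⟩, ⟨.inr (.inl d), rfl⟩, ⟨.inr (.inr p), rfl⟩]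

theorem ham_self {V Val : Type*} (s : V → Val) : ham s s = 0 := by
  simp [ham]

theorem ham_relocate_le {k : ℕ} (s t : HVar k → HVal k) (d : Fin k) (x x' : HPos k) :
    ham s (relocate t d x x') ≤ ham s t + 3 := by
  have := finite_hVar k
  have hsub : {v | s v ≠ relocate t d x x' v} ⊆
      {v | s v ≠ t v} ∪ {.clear x, .clear x', .on d} := by
    intro v hv
    simp only [Set.mem_ofPred_eq, relocate_apply] at hv
    simp only [Set.mem_union, Set.mem_ofPred_eq, Set.mem_insert_iff, Set.mem_singleton_iff]
    grind
  refine (Set.ncard_le_ncard hsub (Set.toFinite _)).trans ((Set.ncard_union_le _ _).trans ?_)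
  refine Nat.add_le_add_left ((Set.ncard_insert_le _ _).trans ?_) _
  exact Nat.succ_le_succ ((Set.ncard_insert_le _ _).trans (by rw [Set.ncard_singleton]))

theorem hInit_mem_hD {k : ℕ} (v : HVar k) : hInit k v ∈ hD v := by
  rcases v with d | d | p
  · exact ⟨initPos d, rfl⟩
  all_goals
    simp only [hInit, hD, Set.mem_ofPred_eq]
    split_ifs <;> simp

theorem initPos_of_lt {k : ℕ} {l : Fin k} (hl : (l : ℕ) + 1 < k) :
    initPos l = .disk ⟨(l : ℕ) + 1, hl⟩ := dif_pos hl

theorem initPos_ne_disk {k : ℕ} {l m : Fin k} (hml : m ≤ l) : initPos l ≠ .disk m := by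
  unfold initPos
  split_ifs
  · simp only [ne_eq, HPos.disk.injEq, Fin.ext_iff]
    have : (m : ℕ) ≤ l := hml
    omega
  · simp

theorem initPos_ne_peg {k : ℕ} (l : Fin k) {p : Fin 3} (hp : p ≠ 0) : initPos l ≠ .peg p := by
  unfold initPos
  split_ifs
  · simp
  · simpa using hp.symm

/-- The recursive step in Towers of Hanoi: `subtow-pos_{i+1,x,x'}` is realized by
the classical three-step recursion, staying within Hamming distance 7 of `init`.
(Here `i : Fin k` is 0-indexed, so it plays the role of the 1-indexed `i` of the
statement, and `j` plays the role of `i+1`.) -/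
theorem hanoi_recursive_step (k : ℕ) (i : Fin k) (h : (i : ℕ) + 1 < k)
    (x' y : HPos k)
    (hxy : (x' = .peg 1 ∧ y = .peg 2) ∨ (x' = .peg 2 ∧ y = .peg 1)) :
    let j : Fin k := ⟨(i : ℕ) + 1, h⟩
    let x : HPos k := initPos j
    let a1 := subtowPos i (.disk j) y
    let a2 := hMove j x x'
    let a3 := subtowPos i y (.disk j)
    Applicable (hInit k) a1 ∧
    Applicable (appA (hInit k) a1) a2 ∧
    Applicable (appP (hInit k) [a1, a2]) a3 ∧
    appP (hInit k) [a1] ∈ Hball hD (hInit k) 7 ∧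
    appP (hInit k) [a1, a2] ∈ Hball hD (hInit k) 7 ∧
    appP (hInit k) [a1, a2, a3] ∈ Hball hD (hInit k) 7 ∧
    appP (hInit k) [a1, a2, a3] = appA (hInit k) (subtowPos j x x') := by
  intro j x a1 a2 a3
  have hij : i ≠ j := Fin.ne_of_val_ne (Nat.succ_ne_self i).symm
  have hxi : ∀ m : Fin k, m ≤ j → x ≠ .disk m := fun m hm => initPos_ne_disk hm
  obtain ⟨p, q, hp, hq, hpq, rfl, rfl⟩ : ∃ p q : Fin 3, p ≠ 0 ∧ q ≠ 0 ∧ p ≠ q ∧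
      x' = .peg p ∧ y = .peg q := by
    rcases hxy with ⟨rfl, rfl⟩ | ⟨rfl, rfl⟩
    exacts [⟨1, 2, by decide, by decide, by decide, rfl, rfl⟩,
      ⟨2, 1, by decide, by decide, by decide, rfl, rfl⟩]
  have hxp : x ≠ .peg p := initPos_ne_peg j hp
  have hxq : x ≠ .peg q := initPos_ne_peg j hq
  have hclear : ∀ {r : Fin 3}, r ≠ 0 → hInit k (.clear (.peg r)) = .T := fun hr =>
    if_neg (Fin.val_ne_of_ne hr)
  have hon : hInit k (.on i) = .pos (.disk j) := congrArg HVal.pos (initPos_of_lt h)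
  have htower : ∀ (n : Fin k) (l : Fin k) (hl : (l : ℕ) + 1 ≤ (n : ℕ)),
      hInit k (.on l) = .pos (.disk ⟨(l : ℕ) + 1, lt_of_le_of_lt hl n.isLt⟩) :=
    fun n l hl => congrArg HVal.pos (initPos_of_lt (lt_of_le_of_lt hl n.isLt))
  have htop : hInit k (.clear (.disk ⟨0, i.pos⟩)) = .T := rfl
  have h_top_ne : (⟨0, i.pos⟩ : Fin k) ≠ j := Fin.ne_of_val_ne (Nat.succ_ne_zero i).symm
  have hbottom : hInit k (.clear (.disk j)) = .F := rfl
  have happ1 : Applicable (hInit k) a1 :=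
    applicable_subtowPos hon (htower i) htop (hclear hq)
  have hs1 : appA (hInit k) a1 = relocate (hInit k) i (.disk j) (.peg q) :=
    appA_subtowPos happ1
  have happ2 : Applicable (relocate (hInit k) i (.disk j) (.peg q)) a2 := by
    apply applicable_hMove
    · simp [relocate_apply, hij.symm, hInit, x]
    · simp [relocate_apply]
    · simpa [relocate_apply, hpq] using hclear hp
  have hs2 := appA_hMove hxp happ2
  have happ3 : Applicable
      (relocate (relocate (hInit k) i (.disk j) (.peg q)) j x (.peg p)) a3 := by
    apply applicable_subtowPos
    · simp [relocate_apply, hij]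
    · intro l hl
      have hli : l ≠ i := by rintro rfl; omega
      have hlj : l ≠ j := by rintro rfl; simp only [j] at hl; omega
      simpa [relocate_apply, hli, hlj] using htower i l hl
    · simpa [relocate_apply, h_top_ne] using fun _ => htop
    · simp [relocate_apply]
  have hs3 := (appA_subtowPos happ3).trans (relocate_conj hij hxq (hxi j le_rfl) (by simpa using hpq)
    (by simp) hon hbottom (hclear hq))
  have happ : Applicable (hInit k) (subtowPos j x (.peg p)) :=
    applicable_subtowPos rfl (htower j) htop (hclear hp)
  have hball1 := ham_relocate_le (hInit k) (hInit k) i (.disk j) (.peg q)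
  have hball2 := ham_relocate_le (hInit k) (relocate (hInit k) i (.disk j) (.peg q)) j x (.peg p)
  have hball3 := ham_relocate_le (hInit k) (hInit k) j x (.peg p)
  rw [ham_self] at hball1 hball3
  have hD1 := relocate_mem_hD (hInit_mem_hD (k := k)) i (.disk j) (.peg q)
  simp only [appP, List.foldl_cons, List.foldl_nil]
  rw [hs1, hs2, hs3, appA_subtowPos happ]
  exact ⟨happ1, happ2, happ3, ⟨hD1, by omega⟩, ⟨relocate_mem_hD hD1 _ _ _, by omega⟩,
    ⟨relocate_mem_hD hInit_mem_hD _ _ _, by omega⟩, rfl⟩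

end

end OnTheFlyMacros
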